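/- For g ≥ 1, the commutator subgroup of the surface group π = ⟨x₁,…,x_{2g} | [x₁,x₂]⋯[x_{2g−1},x_{2g}] = 1⟩ is freely generated by the set { (x_i^{k_i} x_{i+1}^{k_{i+1}} ⋯ x_{2g}^{k_{2g}})⁻¹ [x_i,x_j] (x_i^{k_i} x_{i+1}^{k_{i+1}} ⋯ x_{2g}^{k_{2g}}) : 1 ≤ i < j ≤ 2g, (i,j) ≠ (1,2), k_i,…,k_{2g} ∈ ℤ }. -/

import Mathlib

/-- `S` is a free basis of the subgroup `H` of `G`. -/
def IsFreeBasis {G : Type*} [Group G] (S : Set G) (H : Subgroup G) : Prop :=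
  Function.Injective (FreeGroup.lift ((↑) : S → G)) ∧
    (FreeGroup.lift ((↑) : S → G)).range = H

/-- The surface relator `[x₁,x₂]⋯[x_{2g-1},x_{2g}]` (with `[a,b] = a⁻¹b⁻¹ab`). -/
def surfRel (g : ℕ) : FreeGroup (Fin (2 * g)) :=
  ((List.finRange g).map fun i : Fin g =>
    (FreeGroup.of (⟨2 * i, by have := i.isLt; omega⟩ : Fin (2 * g)))⁻¹ *
      (FreeGroup.of (⟨2 * i + 1, by have := i.isLt; omega⟩ : Fin (2 * g)))⁻¹ *
      FreeGroup.of (⟨2 * i, by have := i.isLt; omega⟩ : Fin (2 * g)) *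
      FreeGroup.of (⟨2 * i + 1, by have := i.isLt; omega⟩ : Fin (2 * g))).prod

/-- The genus-`g` surface group. -/
def SurfaceGroup (g : ℕ) : Type :=
  PresentedGroup {surfRel g}

instance (g : ℕ) : Group (SurfaceGroup g) :=
  QuotientGroup.Quotient.group _

/-- The generators of the surface group. -/
def xgen {g : ℕ} (i : Fin (2 * g)) : SurfaceGroup g :=
  PresentedGroup.of i

/-- The ordered word `x_i^{k_i} x_{i+1}^{k_{i+1}} ⋯ x_{2g}^{k_{2g}}` in the surface group. -/
def tailWord (g : ℕ) (i : Fin (2 * g)) (k : Fin (2 * g) → ℤ) : SurfaceGroup g :=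
  (((List.finRange (2 * g)).filter fun l => i ≤ l).map fun l => xgen l ^ k l).prod

abbrev ee {n : ℕ} (i : Fin n) : Fin n → ℤ := Pi.single i 1

theorem exists_int_prod {A : Type*} [Group A] (f : ℤ → A) :
    ∃ P : ℤ → A, P 0 = 1 ∧ ∀ z, P (z + 1) = P z * f z := by
  let p : ℕ → A := fun k => Nat.rec 1 (fun k a => a * f k) k
  let q : ℕ → A := fun k => Nat.rec 1 (fun k a => a * (f (-((k : ℤ) + 1)))⁻¹) k
  have hp0 : p 0 = 1 := rfl
  have hp : ∀ k : ℕ, p (k + 1) = p k * f k := fun k => rfl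
  have hq0 : q 0 = 1 := rfl
  have hq : ∀ k : ℕ, q (k + 1) = q k * (f (-((k : ℤ) + 1)))⁻¹ := fun k => rfl
  refine ⟨fun z => if 0 ≤ z then p z.toNat else q (-z).toNat, by simp [hp0], ?_⟩
  intro z
  rcases lt_trichotomy z (-1) with h | h | h
  · obtain ⟨k, rfl⟩ : ∃ k : ℕ, z = -((k : ℤ) + 2) := ⟨(-z - 2).toNat, by omega⟩
    have h1 : (-(-((k : ℤ) + 2) + 1)).toNat = k + 1 := by omega
    have h2 : (-(-((k : ℤ) + 2))).toNat = k + 1 + 1 := by omega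
    have h3 : -(((k + 1 : ℕ) : ℤ) + 1) = -((k : ℤ) + 2) := by push_cast; ring
    simp only [if_neg (show ¬ (0 ≤ -((k : ℤ) + 2) + 1) by omega),
      if_neg (show ¬ (0 ≤ -((k : ℤ) + 2)) by omega), h1, h2]
    rw [hq (k + 1), h3]; simp
  · subst h
    have h2 : (1 : ℤ).toNat = 0 + 1 := rfl
    simp [hp0, hq0, hq, h2]
  · obtain ⟨k, rfl⟩ : ∃ k : ℕ, z = k := ⟨z.toNat, by omega⟩
    have h1 : ((k : ℤ) + 1).toNat = k + 1 := by omega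
    simp only [if_pos (show (0 : ℤ) ≤ (k : ℤ) + 1 by omega),
      if_pos (show (0 : ℤ) ≤ (k : ℤ) by omega), h1, Int.toNat_natCast]
    exact hp k

theorem exists_label {A : Type*} [Group A] {n : ℕ} (j : Fin n) (s : Fin n → (Fin n → ℤ) → A) :
    ∃ α : (Fin n → ℤ) → A, (∀ v, (∀ l < j, v l = 0) → α v = 1) ∧
      ∀ i < j, ∀ v, (∀ l < i, v l = 0) → α (v + ee i) = α v * (s i v)⁻¹ := by
  have key : ∀ d m : ℕ, m + d = n → ∃ α : (Fin n → ℤ) → A, (∀ v, (∀ l < j, v l = 0) → α v = 1) ∧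
      ∀ i < j, m ≤ (i : ℕ) → ∀ v, (∀ l < i, v l = 0) → α (v + ee i) = α v * (s i v)⁻¹ := by
    intro d
    induction d with
    | zero =>
      intro m hm
      refine ⟨fun _ => 1, fun _ _ => rfl, fun i _ hi => ?_⟩
      have := i.isLt
      omega
    | succ d ih =>
      intro m hm
      obtain ⟨α, h1, h2⟩ := ih (m + 1) (by omega)
      by_cases hj : m < (j : ℕ)
      · let M : Fin n := ⟨m, by omega⟩
        choose P hP0 hP using @exists_int_prod A _
        refine ⟨fun v => α (Function.update v M 0) *
          P (fun t => (s M (Function.update v M t))⁻¹) (v M), ?_, ?_⟩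
        · intro v hv
          have hM : v M = 0 := hv M hj
          have : Function.update v M 0 = v := by rw [← hM]; simp
          simp only [this, hM, hP0, mul_one]
          exact h1 v hv
        · intro i hij hmi v hv
          rcases eq_or_lt_of_le hmi with he | hl
          · have : i = M := Fin.ext he.symm
            rw [← this]
            have h3 : ∀ t, Function.update (v + ee i) i t = Function.update v i t := by
              intro t; ext l
              by_cases h : l = i
              · subst h; simp
              · simp [h, ee]
            have h4 : (v + ee i) i = v i + 1 := by simp [ee]
            simp only [h3, h4, hP]
            simp [mul_assoc]
          · have hMi : M < i := hl
            have hM : v M = 0 := hv M hMi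
            have hM' : (v + ee i) M = 0 := by simp [ee, hM, hMi.ne]
            have e1 : Function.update v M 0 = v := by
              conv_lhs => rw [← hM]
              simp
            have e2 : Function.update (v + ee i) M 0 = v + ee i := by
              conv_lhs => rw [← hM']
              simp
            simp only [hM, hM', hP0, mul_one, e1, e2]
            exact h2 i hij hl v hv
      · refine ⟨α, h1, fun i hij hmi => h2 i hij ?_⟩
        have : (i : ℕ) < j := hij
        omega
  obtain ⟨α, h1, h2⟩ := key n 0 (by omega)
  exact ⟨α, h1, fun i hij => h2 i hij (by omega)⟩

theorem mem_of_edges {G : Type*} [Group G] {n : ℕ} (j : Fin n) (B : Subgroup G)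
    (f : (Fin n → ℤ) → G) (h1 : ∀ v, (∀ l < j, v l = 0) → f v ∈ B)
    (h2 : ∀ i < j, ∀ v, (∀ l < i, v l = 0) → (f (v + ee i))⁻¹ * f v ∈ B) : ∀ v, f v ∈ B := by
  have key : ∀ d m : ℕ, m + d = n → ∀ v, (∀ l : Fin n, (l : ℕ) < m → v l = 0) → f v ∈ B := by
    intro d
    induction d with
    | zero =>
      intro m hm v hv
      exact h1 v fun l _ => hv l (by have := l.isLt; omega)
    | succ d ih =>
      intro m hm v hv
      by_cases hj : m < (j : ℕ)
      · let M : Fin n := ⟨m, by omega⟩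
        have step : ∀ t : ℤ, f (Function.update v M (t + 1)) ∈ B ↔ f (Function.update v M t) ∈ B := by
          intro t
          have h3 := h2 M hj (Function.update v M t) (by
            intro l hl
            rw [Function.update_of_ne hl.ne]
            exact hv l hl)
          have h4 : Function.update v M t + ee M = Function.update v M (t + 1) := by
            ext l
            by_cases h : l = M
            · subst h; simp
            · simp [h, ee]
          rw [h4] at h3
          rw [← Subgroup.inv_mem_iff B (x := f (Function.update v M (t + 1)))]
          constructor
          · intro h; exact (Subgroup.mul_mem_cancel_left B h).1 h3
          · intro h; exact (Subgroup.mul_mem_cancel_right B h).1 h3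
        have all : ∀ t : ℤ, f (Function.update v M t) ∈ B := by
          intro t
          induction t using Int.induction_on with
          | zero =>
            refine ih (m + 1) (by omega) _ fun l hl => ?_
            by_cases h : l = M
            · subst h; simp
            · rw [Function.update_of_ne h]
              refine hv l ?_
              have : (l : ℕ) ≠ m := fun h' => h (Fin.ext h')
              omega
          | succ k hk => exact (step _).2 hk
          | pred k hk => 
            refine (step _).1 ?_
            simpa using hk
        simpa using all (v M)
      · exact h1 v fun l hl => hv l (by have : (l : ℕ) < j := hl; omega)
  exact fun v => key n 0 (by omega) v (by intro l hl; omega)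

/-- ordered word -/
def TT {G : Type*} [Group G] {n : ℕ} (x : Fin n → G) (L : List (Fin n)) (v : Fin n → ℤ) : G :=
  (L.map fun l => x l ^ v l).prod

theorem TT_congr {G : Type*} [Group G] {n : ℕ} (x : Fin n → G) (L : List (Fin n))
    (v w : Fin n → ℤ) (h : ∀ l ∈ L, v l = w l) : TT x L v = TT x L w := by
  unfold TT
  congr 1
  exact List.map_congr_left fun l hl => by rw [h l hl]

theorem TT_filter {G : Type*} [Group G] {n : ℕ} (x : Fin n → G) (L : List (Fin n)) (i : Fin n)
    (v : Fin n → ℤ) (h : ∀ l < i, v l = 0) :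
    TT x (L.filter fun l => i ≤ l) v = TT x L v := by
  induction L with
  | nil => rfl
  | cons a L ih =>
    unfold TT at ih ⊢
    by_cases ha : i ≤ a
    · simp [ha, ih]
    · simp [ha, ih, h a (not_le.1 ha)]

theorem TT_succ {G : Type*} [Group G] {n : ℕ} (x : Fin n → G) (L : List (Fin n)) (j : Fin n)
    (hL : L.Pairwise (· < ·)) (hj : j ∈ L) (v : Fin n → ℤ) (h : ∀ l < j, v l = 0) :
    TT x L (v + ee j) = x j * TT x L v := by
  induction L with
  | nil => simp at hj
  | cons a L ih =>
    rw [List.pairwise_cons] at hL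
    have hc : ∀ w, TT x (a :: L) w = x a ^ w a * TT x L w := fun w => by simp [TT]
    rw [hc, hc]
    by_cases haj : j = a
    · subst haj
      rw [TT_congr x L (v + ee j) v (by
        intro l hl
        simp [ee, (hL.1 l hl).ne'])]
      simp [ee, zpow_add, ← mul_assoc]
      rw [← zpow_one_add, add_comm, zpow_add_one]
    · have hj' : j ∈ L := by simpa [haj] using hj
      have hlt := hL.1 j hj'
      rw [ih hL.2 hj']
      simp [ee, h a hlt, hlt.ne]

theorem pairwise_finRange (n : ℕ) : (List.finRange n).Pairwise (· < ·) := by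
  exact List.pairwise_lt_finRange n

/-- elementary permutation -/
def EE {A : Type*} [Group A] {n : ℕ} (α : Fin n → (Fin n → ℤ) → A) (j : Fin n) :
    Equiv.Perm ((Fin n → ℤ) × A) where
  toFun p := (p.1 + ee j, α j p.1 * p.2)
  invFun p := (p.1 - ee j, (α j (p.1 - ee j))⁻¹ * p.2)
  left_inv p := by simp
  right_inv p := by simp

theorem EE_apply {A : Type*} [Group A] {n : ℕ} (α : Fin n → (Fin n → ℤ) → A) (j : Fin n)
    (v : Fin n → ℤ) (a : A) : EE α j (v, a) = (v + ee j, α j v * a) := rfl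

theorem EE_inv_apply {A : Type*} [Group A] {n : ℕ} (α : Fin n → (Fin n → ℤ) → A) (j : Fin n)
    (v : Fin n → ℤ) (a : A) : (EE α j)⁻¹ (v + ee j, a) = (v, (α j v)⁻¹ * a) := by
  rw [Equiv.Perm.inv_eq_iff_eq, EE_apply]; simp

/-- label of a commutator loop -/
def KK {A : Type*} [Group A] {n : ℕ} (α : Fin n → (Fin n → ℤ) → A) (i j : Fin n)
    (v : Fin n → ℤ) : A :=
  (α i v)⁻¹ * (α j (v + ee i))⁻¹ * α i (v + ee j) * α j v

theorem EE_comm {A : Type*} [Group A] {n : ℕ} (α : Fin n → (Fin n → ℤ) → A) (i j : Fin n)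
    (v : Fin n → ℤ) (a : A) :
    ((EE α i)⁻¹ * (EE α j)⁻¹ * EE α i * EE α j) (v, a) = (v, KK α i j v * a) := by
  simp only [Equiv.Perm.mul_apply, EE_apply]
  rw [add_right_comm, EE_inv_apply, EE_inv_apply]
  simp [KK, mul_assoc]

theorem EE_zpow {A : Type*} [Group A] {n : ℕ} (α : Fin n → (Fin n → ℤ) → A) (j : Fin n)
    (hα : ∀ v, (∀ l < j, v l = 0) → α j v = 1) (v : Fin n → ℤ) (hv : ∀ l < j, v l = 0) (a : A)
    (t : ℤ) : (EE α j ^ t) (v, a) = (v + Pi.single j t, a) := by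
  have hs : ∀ t : ℤ, α j (v + Pi.single j t) = 1 := fun t => hα _ fun l hl => by
    simp [hv l hl, hl.ne]
  have ht : ∀ t : ℤ, EE α j (v + Pi.single j t, a) = (v + Pi.single j (t + 1), a) := fun t => by
    rw [EE_apply, hs, one_mul, add_assoc, ee, ← Pi.single_add]
  induction t using Int.induction_on with
  | zero => simp
  | succ k hk => rw [add_comm (k : ℤ) 1, zpow_one_add, Equiv.Perm.mul_apply, hk, ht, add_comm (k : ℤ) 1]
  | pred k hk =>
    have := ht (-k - 1)
    rw [sub_add_cancel, ← hk] at this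
    have h2 : EE α j ^ (-(k:ℤ)) = EE α j * EE α j ^ (-(k:ℤ) - 1) := by
      rw [← zpow_one_add]; congr 1; ring
    rw [h2, Equiv.Perm.mul_apply] at this
    exact ((EE α j).injective this).symm

theorem EE_TT {A : Type*} [Group A] {n : ℕ} (α : Fin n → (Fin n → ℤ) → A)
    (hα : ∀ j v, (∀ l < j, v l = 0) → α j v = 1) (L : List (Fin n)) (hL : L.Pairwise (· < ·))
    (k : Fin n → ℤ) (a : A) :
    TT (EE α) L k (0, a) = (fun l => if l ∈ L then k l else 0, a) := by
  induction L with
  | nil => simp [TT]; rfl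
  | cons b L ih =>
    rw [List.pairwise_cons] at hL
    have hc : TT (EE α) (b :: L) k = EE α b ^ k b * TT (EE α) L k := by simp [TT]
    have hb : ∀ l ≤ b, l ∉ L := fun l hl h => absurd (hL.1 l h) (not_lt.2 hl)
    rw [hc, Equiv.Perm.mul_apply, ih hL.2, EE_zpow α b (hα b) _ (by
      intro l hl; simp [hb l hl.le])]
    congr 1
    ext l
    by_cases h : l = b
    · subst h; simp [hb l le_rfl]
    · simp [h]

theorem commutator_loop {G : Type*} [Group G] {n : ℕ} (x : Fin n → G) (T : (Fin n → ℤ) → G)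
    (i j : Fin n) (v : Fin n → ℤ) :
    (T v)⁻¹ * ((x i)⁻¹ * (x j)⁻¹ * x i * x j) * T v =
      KK (fun j v => (T (v + ee j))⁻¹ * x j * T v) i j v := by
  simp only [KK]
  rw [add_right_comm v (ee j) (ee i)]
  group

def i0 {g : ℕ} (m : Fin g) : Fin (2 * g) := ⟨2 * m, by have := m.isLt; omega⟩
def i1 {g : ℕ} (m : Fin g) : Fin (2 * g) := ⟨2 * m + 1, by have := m.isLt; omega⟩

theorem i0_zero {g : ℕ} : ((i0 (0 : Fin (g + 1)) : Fin (2 * (g + 1))) : ℕ) = 0 := by simp [i0]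
theorem i1_zero {g : ℕ} : ((i1 (0 : Fin (g + 1)) : Fin (2 * (g + 1))) : ℕ) = 1 := by
  show 2 * ((0 : Fin (g + 1)) : ℕ) + 1 = 1
  simp

theorem surf_lift {g : ℕ} {H : Type*} [Group H] (f : Fin (2 * g) → H) :
    FreeGroup.lift f (surfRel g) = ((List.finRange g).map fun m =>
      (f (i0 m))⁻¹ * (f (i1 m))⁻¹ * f (i0 m) * f (i1 m)).prod := by
  unfold surfRel
  rw [map_list_prod, List.map_map]
  congr 1
  apply List.map_congr_left
  intro m _
  simp [i0, i1]

theorem surf_hom {g : ℕ} {H : Type*} [Group H] (f : Fin (2 * g) → H)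
    (h : ((List.finRange g).map fun m =>
      (f (i0 m))⁻¹ * (f (i1 m))⁻¹ * f (i0 m) * f (i1 m)).prod = 1) :
    ∃ ρ : SurfaceGroup g →* H, ∀ i, ρ (xgen i) = f i := by
  have h' : ∀ r ∈ ({surfRel g} : Set _), FreeGroup.lift f r = 1 := by
    intro r hr
    rw [Set.mem_singleton_iff.1 hr, surf_lift, h]
  exact ⟨(PresentedGroup.toGroup h' : PresentedGroup {surfRel g} →* H),
    fun i => PresentedGroup.toGroup.of h'⟩

theorem surf_rel (g : ℕ) : ((List.finRange g).map fun m =>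
      (xgen (i0 m) : SurfaceGroup g)⁻¹ * (xgen (i1 m))⁻¹ * xgen (i0 m) * xgen (i1 m)).prod = 1 := by
  rw [← surf_lift]
  have h : FreeGroup.lift (xgen : Fin (2 * g) → SurfaceGroup g) =
      (PresentedGroup.mk {surfRel g} : FreeGroup _ →* PresentedGroup {surfRel g}) := by
    ext i
    rw [FreeGroup.lift_apply_of]
    rfl
  rw [h]
  exact PresentedGroup.one_of_mem (rels := {surfRel g}) rfl

theorem surf_closure (g : ℕ) :
    Subgroup.closure (Set.range (xgen : Fin (2 * g) → SurfaceGroup g)) = ⊤ :=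
  PresentedGroup.closure_range_of {surfRel g}

/-- the generating set -/
def SS (g : ℕ) : Set (SurfaceGroup g) :=
  {y : SurfaceGroup g | ∃ i j : Fin (2 * g), i < j ∧ ¬((i : ℕ) = 0 ∧ (j : ℕ) = 1) ∧
        ∃ k : Fin (2 * g) → ℤ,
          y = (tailWord g i k)⁻¹ * ((xgen i)⁻¹ * (xgen j)⁻¹ * xgen i * xgen j) * tailWord g i k}

theorem tailWord_eq (g : ℕ) (i : Fin (2 * g)) (k : Fin (2 * g) → ℤ) :
    tailWord g i k = TT xgen ((List.finRange (2 * g)).filter fun l => i ≤ l) k := rfl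

theorem conj_list_prod {G : Type*} [Group G] {ι : Type*} (t : G) (L : List ι) (f : ι → G) :
    t⁻¹ * (L.map f).prod * t = (L.map fun m => t⁻¹ * f m * t).prod := by
  induction L with
  | nil => simp
  | cons a L ih =>
    simp only [List.map_cons, List.prod_cons, ← ih]
    group

theorem gen_edge (g : ℕ) (j : Fin (2 * g)) (v : Fin (2 * g) → ℤ) :
    (TT xgen (List.finRange (2 * g)) (v + ee j))⁻¹ * xgen j * TT xgen (List.finRange (2 * g)) v
      ∈ Subgroup.closure (SS g) := by
  set T : (Fin (2 * g) → ℤ) → SurfaceGroup g := TT xgen (List.finRange (2 * g)) with hT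
  set e : Fin (2 * g) → (Fin (2 * g) → ℤ) → SurfaceGroup g :=
    fun j v => (T (v + ee j))⁻¹ * xgen j * T v with he
  set B := Subgroup.closure (SS g)
  change e j v ∈ B
  have tree : ∀ j v, (∀ l < j, v l = 0) → e j v = 1 := by
    intro j v h
    simp only [he, hT]
    rw [TT_succ xgen _ j (pairwise_finRange _) (List.mem_finRange j) v h]
    group
  have loop : ∀ i j, ∀ v, (T v)⁻¹ * ((xgen i)⁻¹ * (xgen j)⁻¹ * xgen i * xgen j) * T v =
      KK e i j v := fun i j v => commutator_loop xgen T i j v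
  have loop' : ∀ i j, i < j → ∀ v, (∀ l < i, v l = 0) →
      KK e i j v = (e j (v + ee i))⁻¹ * e j v := by
    intro i j hij v hv
    have h2 : e i (v + ee j) = 1 := tree i _ fun l hl => by
      simp [ee, hv l hl, (hl.trans hij).ne]
    simp [KK, tree i v hv, h2]
  have sq : ∀ i j : Fin (2 * g), i < j → ¬((i : ℕ) = 0 ∧ (j : ℕ) = 1) → ∀ v, (∀ l < i, v l = 0) →
      (e j (v + ee i))⁻¹ * e j v ∈ B := by
    intro i j hij hne v hv
    rw [← loop' i j hij v hv, ← loop]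
    refine Subgroup.subset_closure ⟨i, j, hij, hne, v, ?_⟩
    rw [tailWord_eq, TT_filter xgen _ i v hv]
  have big : ∀ j : Fin (2 * g), (j : ℕ) ≠ 1 → ∀ v, e j v ∈ B := by
    intro j hj
    refine mem_of_edges j B (e j) (fun v h => by rw [tree j v h]; exact one_mem _) ?_
    intro i hij v hv
    exact sq i j hij (by tauto) v hv
  by_cases hj : (j : ℕ) = 1
  swap
  · exact big j hj v
  revert v
  refine mem_of_edges j B (e j) (fun v h => by rw [tree j v h]; exact one_mem _) ?_
  intro i hij v hv
  have hij' : (i : ℕ) < j := hij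
  rw [← loop' i j hij v hv]
  obtain ⟨g, rfl⟩ : ∃ g', g = g' + 1 := ⟨g - 1, by have := j.isLt; omega⟩
  have hR := conj_list_prod (T v) (List.finRange (g + 1)) (fun m =>
      (xgen (i0 m) : SurfaceGroup (g + 1))⁻¹ * (xgen (i1 m))⁻¹ * xgen (i0 m) * xgen (i1 m))
  rw [surf_rel] at hR
  simp only [loop] at hR
  rw [List.finRange_succ, List.map_cons, List.prod_cons, List.map_map] at hR
  have e0 : (i0 0 : Fin (2 * (g + 1))) = i := Fin.ext (by rw [i0_zero]; omega)
  have e1 : (i1 0 : Fin (2 * (g + 1))) = j := Fin.ext (by rw [i1_zero]; omega)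
  rw [e0, e1] at hR
  rw [mul_one, inv_mul_cancel] at hR
  rw [eq_inv_of_mul_eq_one_left hR.symm]
  refine inv_mem (Subgroup.list_prod_mem _ ?_)
  intro y hy
  obtain ⟨m, _, rfl⟩ := List.mem_map.1 hy
  have b0 := big (i0 m.succ) (by simp [i0])
  have b1 := big (i1 m.succ) (by simp [i1])
  exact mul_mem (mul_mem (mul_mem (inv_mem (b0 _)) (inv_mem (b1 _))) (b0 _)) (b1 _)

theorem comm_le (g : ℕ) : commutator (SurfaceGroup g) ≤ Subgroup.closure (SS g) := by
  set T : (Fin (2 * g) → ℤ) → SurfaceGroup g := TT xgen (List.finRange (2 * g)) with hT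
  set B := Subgroup.closure (SS g)
  have all : ∀ y : SurfaceGroup g, ∃ d, ∀ v, (T (v + d))⁻¹ * y * T v ∈ B := by
    intro y
    have hy : y ∈ Subgroup.closure (Set.range (xgen : Fin (2 * g) → SurfaceGroup g)) := by
      rw [surf_closure]; trivial
    induction hy using Subgroup.closure_induction with
    | mem x hx =>
      obtain ⟨j, rfl⟩ := hx
      exact ⟨ee j, gen_edge g j⟩
    | one => exact ⟨0, fun v => by simp⟩
    | mul x y _ _ hx hy =>
      obtain ⟨d, hd⟩ := hx
      obtain ⟨d', hd'⟩ := hy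
      refine ⟨d' + d, fun v => ?_⟩
      have := mul_mem (hd (v + d')) (hd' v)
      rw [add_assoc] at this
      convert this using 1
      group
    | inv x _ hx =>
      obtain ⟨d, hd⟩ := hx
      refine ⟨-d, fun v => ?_⟩
      have := inv_mem (hd (v + -d))
      rw [neg_add_cancel_right] at this
      convert this using 1
      group
  unfold commutator
  rw [Subgroup.commutator_le]
  intro x _ y _
  obtain ⟨d, hd⟩ := all x
  obtain ⟨d', hd'⟩ := all y
  have hT0 : T 0 = 1 := by simp [hT, TT]
  have a1 := hd' (-d')
  have a2 := hd (-d' + -d)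
  have a3 := hd' (-d + -d')
  have a4 := hd (-d)
  rw [neg_add_cancel, hT0] at a1 a4
  rw [neg_add_cancel_right] at a2 a3
  rw [add_comm] at a3
  have h := mul_mem (mul_mem (mul_mem a4 a3) (inv_mem a2)) (inv_mem a1)
  convert h using 1
  rw [commutatorElement_def]
  group

theorem inj_aux (g : ℕ) (hg : 1 ≤ g) :
    Function.Injective (FreeGroup.lift ((↑) : SS g → SurfaceGroup g)) := by
  classical
  let s : Fin (2 * g) → Fin (2 * g) → (Fin (2 * g) → ℤ) → FreeGroup (SS g) := fun i j v =>
    if h : i < j ∧ ¬((i : ℕ) = 0 ∧ (j : ℕ) = 1) then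
      FreeGroup.of ⟨(tailWord g i v)⁻¹ * ((xgen i)⁻¹ * (xgen j)⁻¹ * xgen i * xgen j) *
        tailWord g i v, i, j, h.1, h.2, v, rfl⟩ else 1
  choose β hβ1 hβ2 using fun j => exists_label j (fun i => s i j)
  obtain ⟨g, rfl⟩ : ∃ g', g = g' + 1 := ⟨g - 1, by omega⟩
  let c : (Fin (2 * (g + 1)) → ℤ) → FreeGroup (SS (g + 1)) := fun v =>
    ((List.finRange g).map fun m => KK β (i0 m.succ) (i1 m.succ) v).prod
  obtain ⟨γ, hγ1, hγ2⟩ := exists_label (i1 0 : Fin (2 * (g + 1))) (fun _ v => (c v)⁻¹)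
  let α : Fin (2 * (g + 1)) → (Fin (2 * (g + 1)) → ℤ) → FreeGroup (SS (g + 1)) :=
    fun j => if j = i1 0 then γ else β j
  have α1 : ∀ j v, (∀ l < j, v l = 0) → α j v = 1 := by
    intro j v h
    by_cases hj : j = i1 0
    · subst hj; simpa [α] using hγ1 v h
    · simpa [α, hj] using hβ1 j v h
  have tri : ∀ i j, i < j → ∀ v, (∀ l < i, v l = 0) →
      KK α i j v = (α j (v + ee i))⁻¹ * α j v := by
    intro i j hij v hv
    have h2 : α i (v + ee j) = 1 := α1 i _ fun l hl => by
      simp [ee, hv l hl, (hl.trans hij).ne]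
    simp [KK, α1 i v hv, h2]
  have lt01 : (i0 0 : Fin (2 * (g + 1))) < i1 0 := by rw [Fin.lt_def, i0_zero, i1_zero]; omega
  have no0 : ∀ l : Fin (2 * (g + 1)), ¬ l < i0 0 := by
    intro l h; rw [Fin.lt_def, i0_zero] at h; omega
  have hR : ((List.finRange (g + 1)).map fun m =>
      (EE α (i0 m))⁻¹ * (EE α (i1 m))⁻¹ * EE α (i0 m) * EE α (i1 m)).prod = 1 := by
    have hl : ∀ (L : List (Fin (g + 1))) (v) (a), (L.map fun m =>
      (EE α (i0 m))⁻¹ * (EE α (i1 m))⁻¹ * EE α (i0 m) * EE α (i1 m)).prod (v, a) =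
        (v, (L.map fun m => KK α (i0 m) (i1 m) v).prod * a) := by
      intro L v a
      induction L with
      | nil => simp
      | cons b L ih =>
        rw [List.map_cons, List.prod_cons, Equiv.Perm.mul_apply, ih, EE_comm]
        simp [mul_assoc]
    refine Equiv.ext ?_
    rintro ⟨v, a⟩
    rw [hl, List.finRange_succ, List.map_cons, List.prod_cons, List.map_map]
    have hc : (List.map ((fun m => KK α (i0 m) (i1 m) v) ∘ Fin.succ) (List.finRange g)).prod = c v := by
      simp only [c]
      refine congrArg List.prod (List.map_congr_left ?_)
      intro m _
      have n0 : (i0 m.succ : Fin (2 * (g + 1))) ≠ i1 0 := by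
        intro h; have := congrArg Fin.val h; rw [i1_zero] at this; simp only [i0] at this; omega
      have n1 : (i1 m.succ : Fin (2 * (g + 1))) ≠ i1 0 := by
        intro h; have := congrArg Fin.val h; rw [i1_zero] at this; simp [i1] at this
      simp [KK, α, n0, n1]
    rw [hc, tri _ _ lt01 v (fun l hl => absurd hl (no0 l))]
    have := hγ2 (i0 0) lt01 v (fun l hl => absurd hl (no0 l))
    simp [α, this]
  obtain ⟨ρ, hρ⟩ := surf_hom (EE α) hR
  have hTT : ∀ L k, ρ (TT xgen L k) = TT (EE α) L k := by
    intro L k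
    simp only [TT]
    rw [map_list_prod, List.map_map]
    congr 1
    apply List.map_congr_left
    intro l _
    simp [hρ]
  have gen : ∀ (y : SS (g + 1)) (b), ρ (y : SurfaceGroup (g + 1)) (0, b) = (0, FreeGroup.of y * b) := by
    rintro ⟨y, i, j, hij, hne, k, rfl⟩ b
    let k' : Fin (2 * (g + 1)) → ℤ := fun l => if i ≤ l then k l else 0
    have hw : tailWord (g + 1) i k' = tailWord (g + 1) i k := by
      rw [tailWord_eq, tailWord_eq]
      apply TT_congr
      intro l hl
      have : i ≤ l := by simpa using hl
      simp [k', this]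
    have hk' : ∀ l < i, k' l = 0 := fun l hl => by simp [k', not_le.2 hl]
    have hpath : ∀ b, ρ (tailWord (g + 1) i k) (0, b) = (k', b) := by
      intro b
      rw [tailWord_eq, hTT, EE_TT α α1 _ ((pairwise_finRange _).filter _)]
      simp [k']
    have hj : j ≠ i1 0 := by
      rintro rfl
      have h1 : (i : ℕ) < (i1 0 : Fin (2 * (g + 1))) := hij
      rw [i1_zero] at h1 hne
      omega
    have hlab : KK α i j k' = s i j k' := by
      rw [tri i j hij k' hk']
      simp [α, hj, hβ2 j i hij k' hk']
    have hs : s i j k' = FreeGroup.of (⟨(tailWord (g + 1) i k)⁻¹ *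
        ((xgen i)⁻¹ * (xgen j)⁻¹ * xgen i * xgen j) *
        tailWord (g + 1) i k, i, j, hij, hne, k, rfl⟩ : SS (g + 1)) := by
      simp only [s, dif_pos (And.intro hij hne)]
      congr 1
      exact Subtype.ext (by simp only [hw])
    rw [← hs, ← hlab]
    simp only [map_mul, map_inv, hρ]
    rw [Equiv.Perm.mul_apply, Equiv.Perm.mul_apply, hpath, EE_comm, Equiv.Perm.inv_eq_iff_eq, hpath]
  have main : ∀ (a b : FreeGroup (SS (g + 1))),
      ρ (FreeGroup.lift ((↑) : SS (g + 1) → SurfaceGroup (g + 1)) a) (0, b) = (0, a * b) := by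
    intro a
    induction a using FreeGroup.induction_on with
    | C1 => simp
    | of y => intro b; rw [FreeGroup.lift_apply_of]; exact gen y b
    | inv_of y _ =>
      intro b
      rw [map_inv, map_inv, Equiv.Perm.inv_eq_iff_eq, FreeGroup.lift_apply_of, gen]
      simp
    | mul x y hx hy =>
      intro b
      rw [map_mul, map_mul, Equiv.Perm.mul_apply, hy, hx, mul_assoc]
  intro a b hab
  have h1 := main a 1
  rw [hab, main b 1] at h1
  simpa using h1.symm

/-- For `g ≥ 1`, the commutator subgroup of the genus-`g` surface group is freely
generated by the elements `(x_i^{k_i} ⋯ x_{2g}^{k_{2g}})⁻¹ [x_i,x_j] (x_i^{k_i} ⋯ x_{2g}^{k_{2g}})`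
with `i < j` and `(i,j) ≠ (1,2)` (0-indexed: `(i,j) ≠ (0,1)`). -/
theorem stmt16 (g : ℕ) (hg : 1 ≤ g) :
    IsFreeBasis
      {y : SurfaceGroup g | ∃ i j : Fin (2 * g), i < j ∧ ¬((i : ℕ) = 0 ∧ (j : ℕ) = 1) ∧
        ∃ k : Fin (2 * g) → ℤ,
          y = (tailWord g i k)⁻¹ * ((xgen i)⁻¹ * (xgen j)⁻¹ * xgen i * xgen j) * tailWord g i k}
      (commutator (SurfaceGroup g)) := by
  refine ⟨inj_aux g hg, ?_⟩
  have hr : (FreeGroup.lift ((↑) : SS g → SurfaceGroup g)).range = Subgroup.closure (SS g) := by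
    rw [FreeGroup.range_lift_eq_closure, Subtype.range_coe]
  refine hr.trans (le_antisymm ?_ (comm_le g))
  rw [Subgroup.closure_le]
  rintro y ⟨i, j, _, _, k, rfl⟩
  have h : (xgen i)⁻¹ * (xgen j)⁻¹ * xgen i * xgen j ∈ commutator (SurfaceGroup g) := by
    have := Subgroup.commutator_mem_commutator (Subgroup.mem_top (xgen i : SurfaceGroup g)⁻¹)
      (Subgroup.mem_top (xgen j : SurfaceGroup g)⁻¹)
    simpa [commutatorElement_def, commutator] using this
  have := (inferInstance : (commutator (SurfaceGroup g)).Normal).conj_mem _ h (tailWord g i k)⁻¹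
  simpa using this
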